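/- Parabolic Frostman lemma: Let A ⊆ ℝ^(1+d) be a Borel set with P^α-dim A > β. Then there exists a probability measure μ supported on A such that μ([t, t+c] × ∏_{i=1}^d [x_i, x_i+c^(1/α)]) ≲ c^β for all c ∈ (0,1] and t, x_1, …, x_d ∈ ℝ when α ∈ (0,1], and μ([t, t+c] × ∏_{i=1}^d [x_i, x_i+c^(1/α)]) ≲ c^(β/α) when α ∈ [1,∞), with implied constants independent of c, t, x. -/

import Mathlib

open MeasureTheory Set ENNReal NNReal

noncomputable section

/-- An `α`-parabolic cylinder in `ℝ × ℝ^d`: a set of the form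
`[t, t+c] × ∏_j [x_j, x_j + c^(1/α)]` with `c ∈ (0,1]`. -/
def IsPCyl (α : ℝ) {d : ℕ} (S : Set (ℝ × (Fin d → ℝ))) : Prop :=
  ∃ (t : ℝ) (x : Fin d → ℝ) (c : ℝ), c ∈ Set.Ioc (0:ℝ) 1 ∧
    S = Set.Icc t (t + c) ×ˢ Set.Icc x (fun j => x j + c ^ (1/α))

/-- The `α`-parabolic `β`-Hausdorff (outer) measure: limit as `δ ↓ 0` of the infimum of
`∑ (diam P_k)^β` over countable covers by `α`-parabolic cylinders of diameter `≤ δ`. -/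
def pHaus (α β : ℝ) {d : ℕ} (A : Set (ℝ × (Fin d → ℝ))) : ℝ≥0∞ :=
  ⨆ (δ : ℝ) (_ : 0 < δ),
    ⨅ (P : ℕ → Set (ℝ × (Fin d → ℝ))) (_ : A ⊆ ⋃ k, P k)
      (_ : ∀ k, IsPCyl α (P k)) (_ : ∀ k, EMetric.diam (P k) ≤ ENNReal.ofReal δ),
      ∑' k, EMetric.diam (P k) ^ β

/-- The `α`-parabolic Hausdorff dimension. -/
def pDim (α : ℝ) {d : ℕ} (A : Set (ℝ × (Fin d → ℝ))) : ℝ≥0∞ :=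
  ⨆ (β : ℝ≥0) (_ : pHaus α (β : ℝ) A = ∞), (β : ℝ≥0∞)

open scoped Topology

section NetContent

variable {X ι : Type*}

/-- A family `F` of cells of the partitions `cell k` covers `E`. -/
def NetCovers (cell : ℕ → X → ι) (F : Set (ℕ × ι)) (E : Set X) : Prop :=
  ∀ x ∈ E, ∃ k, (k, cell k x) ∈ F

/-- The total weight of a family of cells, a cell of level `k` having weight `w k`. -/
def netCost (w : ℕ → ℝ≥0∞) (F : Set (ℕ × ι)) : ℝ≥0∞ :=
  ∑' q, F.indicator (fun q => w q.1) q

/-- The least total weight of a cover by cells. -/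
def netContent (cell : ℕ → X → ι) (w : ℕ → ℝ≥0∞) (E : Set X) : ℝ≥0∞ :=
  ⨅ (F : Set (ℕ × ι)) (_ : NetCovers cell F E), netCost w F

/-- The partitions `cell k` get finer as `k` grows. -/
def NetNested (cell : ℕ → X → ι) : Prop :=
  ∀ ⦃k l : ℕ⦄ ⦃x y : X⦄, k ≤ l → cell l x = cell l y → cell k x = cell k y

/-- The maximal cells of a family. -/
def netMax (cell : ℕ → X → ι) (F : Set (ℕ × ι)) : Set (ℕ × ι) :=
  {q ∈ F | ∀ p ∈ F, p.1 < q.1 → ¬ ∃ x, cell p.1 x = p.2 ∧ cell q.1 x = q.2}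

variable {cell : ℕ → X → ι} {w : ℕ → ℝ≥0∞}

lemma netContent_le {F : Set (ℕ × ι)} {E : Set X} (h : NetCovers cell F E) :
    netContent cell w E ≤ netCost w F :=
  iInf₂_le F h

lemma netContent_empty : netContent cell w (∅ : Set X) = 0 := by
  refine le_antisymm ((netContent_le (F := ∅) fun x hx => hx.elim).trans ?_) zero_le
  simp [netCost]

lemma netContent_mono {E E' : Set X} (h : E ⊆ E') : netContent cell w E ≤ netContent cell w E' :=
  le_iInf₂ fun _ hF => netContent_le fun x hx => hF x (h hx)

lemma exists_netCovers_le {E : Set X} (hE : netContent cell w E ≠ ∞) {ε : ℝ≥0∞} (hε : ε ≠ 0) :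
    ∃ F, NetCovers cell F E ∧ netCost w F ≤ netContent cell w E + ε := by
  have h := ENNReal.lt_add_right hE hε
  conv_lhs at h => rw [netContent]
  simp only [iInf_lt_iff] at h
  obtain ⟨F, hF, h⟩ := h
  exact ⟨F, hF, h.le⟩

lemma netMax_exists_le (hn : NetNested cell) {F : Set (ℕ × ι)} {x : X} {k : ℕ}
    (h : (k, cell k x) ∈ F) : ∃ l ≤ k, (l, cell l x) ∈ netMax cell F := by
  classical
  have hex : ∃ k, (k, cell k x) ∈ F := ⟨k, h⟩
  refine ⟨Nat.find hex, Nat.find_min' hex h, Nat.find_spec hex, ?_⟩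
  rintro ⟨m, i⟩ hp hlt ⟨y, hy, hyx⟩
  refine Nat.find_min hex hlt ?_
  rw [← hn hlt.le hyx]
  exact hy ▸ hp

/-- Strong subadditivity: the maximal cells of `F ∪ G` cover the union, and the remaining ones
cover the intersection. -/
lemma netCost_netMax_add_le {F G : Set (ℕ × ι)} {E : Set X}
    (hF : NetCovers cell F E) (hG : NetCovers cell G E) :
    netCost w (netMax cell (F ∪ G)) + netContent cell w E ≤ netCost w F + netCost w G := by
  classical
  set M := netMax cell (F ∪ G) with hM
  have hMsub : M ⊆ F ∪ G := fun q hq => hq.1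
  set R := (F \ M) ∪ (G \ M) ∪ (F ∩ G)
  have hR : NetCovers cell R E := by
    intro x hx
    obtain ⟨k, hk⟩ := hF x hx
    obtain ⟨l, hl⟩ := hG x hx
    rcases lt_trichotomy k l with h | rfl | h
    · exact ⟨l, Or.inl (Or.inr ⟨hl, fun hm => hm.2 _ (Or.inl hk) h ⟨x, rfl, rfl⟩⟩)⟩
    · exact ⟨k, Or.inr ⟨hk, hl⟩⟩
    · exact ⟨k, Or.inl (Or.inl ⟨hk, fun hm => hm.2 _ (Or.inr hl) h ⟨x, rfl, rfl⟩⟩)⟩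
  calc netCost w M + netContent cell w E ≤ netCost w M + netCost w R := by
        gcongr; exact netContent_le hR
    _ ≤ netCost w F + netCost w G := by
        simp only [netCost]
        rw [← ENNReal.tsum_add, ← ENNReal.tsum_add]
        refine ENNReal.tsum_le_tsum fun q => ?_
        have := @hMsub q
        by_cases h1 : q ∈ M <;> by_cases h2 : q ∈ F <;> by_cases h3 : q ∈ G <;>
          simp_all [Set.indicator, R]

/-- The net content is continuous along increasing sequences of arbitrary sets. -/
lemma netContent_iUnion_le (hn : NetNested cell) {E : ℕ → Set X} (hE : Monotone E) :
    netContent cell w (⋃ n, E n) ≤ ⨆ n, netContent cell w (E n) := by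
  classical
  refine ENNReal.le_of_forall_pos_le_add fun ε hε hfin => ?_
  have hne : ∀ n, netContent cell w (E n) ≠ ∞ := fun n =>
    ((le_iSup (fun n => netContent cell w (E n)) n).trans_lt hfin).ne
  obtain ⟨e, he0, he⟩ := ENNReal.exists_pos_sum_of_countable' (ENNReal.coe_pos.2 hε).ne' ℕ
  choose F hFc hFw using fun n => exists_netCovers_le (hne n) (he0 n).ne'
  let G : ℕ → Set (ℕ × ι) := fun n =>
    Nat.rec (F 0) (fun n g => netMax cell (g ∪ F (n + 1))) n
  have hG : ∀ n, G (n + 1) = netMax cell (G n ∪ F (n + 1)) := fun n => rfl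
  have hGc : ∀ n, NetCovers cell (G n) (E n) := by
    intro n
    cases n with
    | zero => exact hFc 0
    | succ n =>
      intro x hx
      obtain ⟨k, hk⟩ := hFc (n + 1) x hx
      obtain ⟨l, -, hl⟩ := netMax_exists_le hn (F := G n ∪ F (n + 1)) (Or.inr hk)
      exact ⟨l, hl⟩
  have hGw : ∀ n, netCost w (G n) ≤ netContent cell w (E n) + ∑ i ∈ Finset.range (n + 1), e i := by
    intro n
    induction n with
    | zero => simpa [G] using hFw 0
    | succ n ih =>
      have h1 := netCost_netMax_add_le (w := w) (hGc n)
        (fun x hx => hFc (n + 1) x (hE n.le_succ hx))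
      rw [← hG] at h1
      have h2 := h1.trans (add_le_add ih (hFw (n + 1)))
      rw [Finset.sum_range_succ]
      refine (ENNReal.add_le_add_iff_right (hne n)).1 (h2.trans_eq ?_)
      ring
  have hbound : ∀ n, netCost w (G n) ≤ (⨆ n, netContent cell w (E n)) + ε := fun n =>
    (hGw n).trans (add_le_add (le_iSup (fun n => netContent cell w (E n)) n)
      ((ENNReal.sum_le_tsum _).trans he.le))
  set L : Set (ℕ × ι) := {q | ∃ N, ∀ n ≥ N, q ∈ G n}
  have hLc : NetCovers cell L (⋃ n, E n) := by
    intro x hx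
    obtain ⟨n, hn'⟩ := mem_iUnion.1 hx
    have hex : ∃ k, ∃ m ≥ n, (k, cell k x) ∈ G m := by
      obtain ⟨k, hk⟩ := hGc n x hn'
      exact ⟨k, n, le_rfl, hk⟩
    obtain ⟨k, ⟨m, hm, hk⟩, hmin⟩ := wellFounded_lt.has_min {k | ∃ m ≥ n, (k, cell k x) ∈ G m} hex
    refine ⟨k, m, ?_⟩
    intro j hj
    induction j, hj using Nat.le_induction with
    | base => exact hk
    | succ j hj ih =>
      obtain ⟨l, hl, hlm⟩ := netMax_exists_le hn (F := G j ∪ F (j + 1)) (Or.inl ih)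
      rw [← hG] at hlm
      have := not_lt.1 (hmin l ⟨j + 1, by omega, hlm⟩)
      rwa [le_antisymm this hl]
  refine (netContent_le hLc).trans ?_
  rw [netCost, ENNReal.tsum_eq_iSup_sum]
  refine iSup_le fun s => ?_
  have hev : ∀ q : ℕ × ι, ∀ᶠ n in Filter.atTop,
      L.indicator (fun q => w q.1) q ≤ (G n).indicator (fun q => w q.1) q := by
    intro q
    rcases em (q ∈ L) with hq | hq
    · obtain ⟨N, hN⟩ := hq
      filter_upwards [Filter.eventually_ge_atTop N] with n hn'
      rw [Set.indicator_of_mem (hN n hn')]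
      exact Set.indicator_le_self' (fun _ _ => zero_le) _
    · rw [Set.indicator_of_notMem hq]
      exact Filter.Eventually.of_forall fun _ => zero_le
  obtain ⟨n, hn'⟩ := ((Filter.eventually_all_finset s).2 fun q _ => hev q).exists
  exact ((Finset.sum_le_sum hn').trans (ENNReal.sum_le_tsum _)).trans (hbound n)

/-- Fractional covers are no better than covers, up to a summable loss in the weights. -/
lemma netContent_le_of_fractional {s : ℕ → ℝ≥0∞} (hs0 : ∀ k, s k ≠ 0) (hs : ∑' k, s k ≠ ∞)
    {K : Set X} {c : ℕ × ι → ℝ≥0∞} (hc : ∀ x ∈ K, 1 ≤ ∑' k, c (k, cell k x)) :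
    netContent cell (fun k => w k * s k) K ≤ 2 * (∑' k, s k) * ∑' q, c q * w q.1 := by
  classical
  set S := ∑' k, s k
  have hS0 : S ≠ 0 := fun h => hs0 0 (ENNReal.tsum_eq_zero.1 h 0)
  have hC0 : 2 * S ≠ 0 := mul_ne_zero two_ne_zero hS0
  have hCt : 2 * S ≠ ∞ := ENNReal.mul_ne_top ENNReal.ofNat_ne_top hs
  set F : Set (ℕ × ι) := {q | s q.1 ≤ 2 * S * c q}
  have hF : NetCovers cell F K := by
    intro x hx
    by_contra! h
    have h1 : ∀ k, c (k, cell k x) ≤ (2 * S)⁻¹ * s k := fun k => by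
      rw [mul_comm, ← div_eq_mul_inv, ENNReal.le_div_iff_mul_le (Or.inl hC0) (Or.inl hCt), mul_comm]
      exact (not_le.1 (h k)).le
    have h2 := (hc x hx).trans (ENNReal.tsum_le_tsum h1)
    rw [ENNReal.tsum_mul_left, ENNReal.mul_inv (Or.inl two_ne_zero) (Or.inl ENNReal.ofNat_ne_top),
      mul_assoc, ENNReal.inv_mul_cancel hS0 hs, mul_one] at h2
    exact absurd h2 (not_le.2 ENNReal.one_half_lt_one)
  refine (netContent_le hF).trans ?_
  rw [netCost, ← ENNReal.tsum_mul_left]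
  refine ENNReal.tsum_le_tsum fun q => ?_
  refine Set.indicator_apply_le' (fun hq => ?_) fun _ => zero_le
  calc w q.1 * s q.1 ≤ w q.1 * (2 * S * c q) := by gcongr; exact hq
    _ = 2 * S * (c q * w q.1) := by ring

variable [TopologicalSpace X]

/-- An open neighbourhood of a family of cells is not much more expensive than the family. -/
lemma netCovers_nbr {nbr : ℕ → ι → Finset ι} {N : ℕ} (hN : ∀ k i, (nbr k i).card ≤ N)
    (hnbr : ∀ k x, {y | cell k y ∈ nbr k (cell k x)} ∈ 𝓝 x) {F : Set (ℕ × ι)} {K : Set X}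
    (hF : NetCovers cell F K) :
    ∃ U, IsOpen U ∧ K ⊆ U ∧ netContent cell w U ≤ N * netCost w F := by
  classical
  refine ⟨interior {y | ∃ q ∈ F, cell q.1 y ∈ nbr q.1 q.2}, isOpen_interior, ?_, ?_⟩
  · intro x hx
    obtain ⟨k, hk⟩ := hF x hx
    exact mem_interior_iff_mem_nhds.2
      (Filter.mem_of_superset (hnbr k x) fun y hy => ⟨_, hk, hy⟩)
  set G : Set (ℕ × ι) := ⋃ q ∈ F, ((nbr q.1 q.2).image (Prod.mk q.1) : Finset (ℕ × ι))
  have hG : NetCovers cell G (interior {y | ∃ q ∈ F, cell q.1 y ∈ nbr q.1 q.2}) := by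
    intro y hy
    obtain ⟨q, hq, hy⟩ := interior_subset hy
    refine ⟨q.1, mem_iUnion₂.2 ⟨q, hq, ?_⟩⟩
    simpa using hy
  refine (netContent_le hG).trans ?_
  simp only [netCost]
  rw [← tsum_subtype, ← tsum_subtype, ← ENNReal.tsum_mul_left]
  refine (ENNReal.tsum_biUnion_le_tsum (fun q : ℕ × ι => w q.1) _ _).trans (ENNReal.tsum_le_tsum fun q => ?_)
  rw [Finset.tsum_subtype' ((nbr (q : ℕ × ι).1 (q : ℕ × ι).2).image (Prod.mk (q : ℕ × ι).1))
    (fun q : ℕ × ι => w q.1)]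
  refine (Finset.sum_le_card_nsmul _ _ (w (q : ℕ × ι).1) ?_).trans ?_
  · intro p hp
    obtain ⟨i, -, rfl⟩ := Finset.mem_image.1 hp
    exact le_rfl
  · rw [nsmul_eq_mul]
    gcongr
    exact Finset.card_image_le.trans (hN _ _)

lemma isCompact_box (n : ℕ → ℕ) : IsCompact {x : ℕ → ℕ | ∀ i, x i ≤ n i} := by
  have : {x : ℕ → ℕ | ∀ i, x i ≤ n i} = Set.pi univ fun i => Set.Iic (n i) := by
    ext; simp [Pi.le_def]
  rw [this]
  exact isCompact_univ_pi fun i => (Set.finite_Iic _).isCompact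

/-- A neighbourhood of the compact box `∏ {0, …, n i}` of Baire space contains one of its
cylindrical approximations. -/
lemma exists_truncated_box_subset {n : ℕ → ℕ} {V : Set (ℕ → ℕ)} (hV : IsOpen V)
    (h : {x | ∀ i, x i ≤ n i} ⊆ V) : ∃ m, {x : ℕ → ℕ | ∀ i < m, x i ≤ n i} ⊆ V := by
  by_contra! hcon
  simp only [Set.not_subset] at hcon
  choose y hy hyV using hcon
  obtain ⟨x, hx, φ, hφ, hlim⟩ := (isCompact_box n).tendsto_subseq (x := fun m i => min (y m i) (n i))
    fun m i => min_le_right _ _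
  have hlim' : Filter.Tendsto (fun m => y (φ m)) Filter.atTop (𝓝 x) := by
    rw [tendsto_pi_nhds] at hlim ⊢
    intro i
    refine (hlim i).congr' ?_
    filter_upwards [Filter.eventually_gt_atTop i] with m hm
    exact min_eq_left (hy (φ m) i (hm.trans_le (hφ.id_le m)))
  exact hV.isClosed_compl.mem_of_tendsto hlim' (Filter.Eventually.of_forall fun m => hyV (φ m))
    (h hx)

/-- Analytic sets of positive net content contain compact sets of positive net content. -/
theorem exists_isCompact_netContent_pos (hn : NetNested cell) {nbr : ℕ → ι → Finset ι} {N : ℕ}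
    (hN : ∀ k i, (nbr k i).card ≤ N)
    (hnbr : ∀ k x, {y | cell k y ∈ nbr k (cell k x)} ∈ 𝓝 x)
    {A : Set X} (hA : AnalyticSet A) (hpos : 0 < netContent cell w A) :
    ∃ K ⊆ A, IsCompact K ∧ 0 < netContent cell w K := by
  rw [AnalyticSet] at hA
  rcases hA with rfl | ⟨f, hf, rfl⟩
  · simp [netContent_empty] at hpos
  obtain ⟨η, hη0, hη⟩ := exists_between hpos
  have step : ∀ (S : {S : Set (ℕ → ℕ) // η < netContent cell w (f '' S)}) (m : ℕ),
      ∃ j, η < netContent cell w (f '' (S.1 ∩ {x | x m ≤ j})) := by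
    rintro ⟨S, hS⟩ m
    have hU : f '' S = ⋃ j, f '' (S ∩ {x | x m ≤ j}) := by
      rw [← image_iUnion, ← inter_iUnion]
      congr
      refine (inter_eq_left.2 fun x _ => mem_iUnion.2 ⟨x m, le_refl (x m)⟩).symm
    dsimp only
    rw [hU] at hS
    refine lt_iSup_iff.1 (hS.trans_le (netContent_iUnion_le hn fun a b hab => ?_))
    exact image_mono (inter_subset_inter_right _ fun x (hx : x m ≤ a) => hx.trans hab)
  choose j hj using step
  let T : ℕ → {S : Set (ℕ → ℕ) // η < netContent cell w (f '' S)} := fun m =>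
    Nat.rec ⟨univ, by simpa using hη⟩ (fun m S => ⟨_, hj S m⟩) m
  let n : ℕ → ℕ := fun m => j (T m) m
  have hT : ∀ m, (T m).1 = {x | ∀ i < m, x i ≤ n i} := by
    intro m
    induction m with
    | zero => simp [T]
    | succ m ih =>
      change (T m).1 ∩ {x | x m ≤ n m} = _
      rw [ih]
      ext x
      simp only [mem_inter_iff, Set.mem_ofPred_eq]
      exact Nat.forall_lt_succ_right.symm
  refine ⟨f '' {x | ∀ i, x i ≤ n i}, image_subset_range _ _, (isCompact_box n).image hf, ?_⟩
  by_contra hK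
  have hK0 := nonpos_iff_eq_zero.1 (not_lt.1 hK)
  have hε : η / (N + 1) ≠ 0 := ENNReal.div_ne_zero.2 ⟨hη0.ne', by finiteness⟩
  obtain ⟨F, hF, hFw⟩ := exists_netCovers_le (hK0.trans_ne ENNReal.zero_ne_top) hε
  obtain ⟨U, hU, hKU, hUw⟩ := netCovers_nbr (w := w) hN hnbr hF
  obtain ⟨m, hm⟩ := exists_truncated_box_subset (hU.preimage hf) (image_subset_iff.1 hKU)
  rw [← hT, ← image_subset_iff] at hm
  refine absurd (T m).2 (not_lt.2 ?_)
  calc netContent cell w (f '' (T m).1) ≤ netContent cell w U := netContent_mono hm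
    _ ≤ N * netCost w F := hUw
    _ ≤ (N + 1) * (η / (N + 1)) := by
      rw [hK0, zero_add] at hFw
      gcongr
      exact le_self_add
    _ ≤ η := ENNReal.mul_div_le

end NetContent

section FractionalCost

variable {X ι : Type*} {cell : ℕ → X → ι} {w : ℕ → ℝ≥0∞} {K : Set X}

/-- The least total weight of a fractional cover of a function on `K` by cells. -/
def fracCost (cell : ℕ → X → ι) (w : ℕ → ℝ≥0∞) (K : Set X) (g : X → ℝ) : ℝ≥0∞ :=
  ⨅ (c : ℕ × ι → ℝ≥0∞) (_ : ∀ x ∈ K, ENNReal.ofReal (g x) ≤ ∑' k, c (k, cell k x)),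
    ∑' q, c q * w q.1

lemma fracCost_add_le (g h : X → ℝ) :
    fracCost cell w K (g + h) ≤ fracCost cell w K g + fracCost cell w K h := by
  simp only [fracCost]
  refine ENNReal.le_iInf₂_add_iInf₂ fun c hc e he => ?_
  refine (iInf₂_le (c + e) fun x hx => ?_).trans_eq ?_
  · simp only [Pi.add_apply]
    rw [ENNReal.tsum_add]
    exact ENNReal.ofReal_add_le.trans (add_le_add (hc x hx) (he x hx))
  · rw [← ENNReal.tsum_add]
    simp only [Pi.add_apply, add_mul]

lemma fracCost_smul_le {t : ℝ} (ht : 0 < t) (g : X → ℝ) :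
    fracCost cell w K (t • g) ≤ ENNReal.ofReal t * fracCost cell w K g := by
  have ht0 : ENNReal.ofReal t ≠ 0 := by simpa using ht
  rw [mul_comm, ← ENNReal.div_le_iff_le_mul (Or.inl ht0) (Or.inl ENNReal.ofReal_ne_top)]
  refine le_iInf₂ fun c hc => ?_
  rw [ENNReal.div_le_iff_le_mul (Or.inl ht0) (Or.inl ENNReal.ofReal_ne_top), mul_comm]
  refine (iInf₂_le (fun q => ENNReal.ofReal t * c q) fun x hx => ?_).trans_eq ?_
  · rw [ENNReal.tsum_mul_left, Pi.smul_apply, smul_eq_mul, ENNReal.ofReal_mul ht.le]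
    gcongr
    exact hc x hx
  · simp only [mul_assoc]
    rw [ENNReal.tsum_mul_left]

lemma fracCost_smul {t : ℝ} (ht : 0 < t) (g : X → ℝ) :
    fracCost cell w K (t • g) = ENNReal.ofReal t * fracCost cell w K g := by
  refine le_antisymm (fracCost_smul_le ht g) ?_
  calc ENNReal.ofReal t * fracCost cell w K g
      = ENNReal.ofReal t * fracCost cell w K (t⁻¹ • t • g) := by rw [inv_smul_smul₀ ht.ne']
    _ ≤ ENNReal.ofReal t * (ENNReal.ofReal t⁻¹ * fracCost cell w K (t • g)) := by
        gcongr; exact fracCost_smul_le (inv_pos.2 ht) _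
    _ = fracCost cell w K (t • g) := by
        rw [← mul_assoc, ← ENNReal.ofReal_mul ht.le, mul_inv_cancel₀ ht.ne', ENNReal.ofReal_one,
          one_mul]

lemma fracCost_le {g : X → ℝ} {M : ℝ} {k : ℕ} (s : Finset ι)
    (hg : ∀ x ∈ K, g x ≤ 0 ∨ g x ≤ M ∧ cell k x ∈ s) :
    fracCost cell w K g ≤ ENNReal.ofReal M * (s.card * w k) := by
  classical
  let c : ℕ × ι → ℝ≥0∞ := fun q => if q ∈ s.image (Prod.mk k) then ENNReal.ofReal M else 0
  refine (iInf₂_le c fun x hx => ?_).trans ?_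
  · rcases hg x hx with h | ⟨h, hs⟩
    · simp [ENNReal.ofReal_of_nonpos h]
    · refine le_trans ?_ (ENNReal.le_tsum k)
      simpa [c, hs] using ENNReal.ofReal_le_ofReal h
  · rw [tsum_eq_sum (s := s.image (Prod.mk k)) fun q hq => by simp only [c, if_neg hq, zero_mul],
      Finset.sum_image fun _ _ _ _ h => (Prod.mk.inj h).2]
    refine (Finset.sum_le_card_nsmul s _ (ENNReal.ofReal M * w k) fun i hi => ?_).trans_eq ?_
    · simp [c, hi]
    · rw [nsmul_eq_mul]
      ring

lemma fracCost_eq_zero {g : X → ℝ} (hg : ∀ x ∈ K, g x ≤ 0) : fracCost cell w K g = 0 := by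
  refine le_antisymm ((fracCost_le (M := 0) (k := 0) ∅ fun x hx => Or.inl (hg x hx)).trans ?_)
    zero_le
  simp

lemma fracCost_pos {s : ℕ → ℝ≥0∞} (hs0 : ∀ k, s k ≠ 0) (hs : ∑' k, s k ≠ ∞)
    (hK : 0 < netContent cell (fun k => w k * s k) K) {g : X → ℝ} (hg : ∀ x ∈ K, 1 ≤ g x) :
    0 < fracCost cell w K g := by
  have hC : 2 * ∑' k, s k ≠ ∞ := ENNReal.mul_ne_top ENNReal.ofNat_ne_top hs
  refine (ENNReal.div_pos hK.ne' hC).trans_le (le_iInf₂ fun c hc => ?_)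
  refine ENNReal.div_le_of_le_mul' (netContent_le_of_fractional hs0 hs fun x hx => ?_)
  exact (ENNReal.one_le_ofReal.2 (hg x hx)).trans (hc x hx)

variable [TopologicalSpace X]

lemma IsCompact.exists_finset_cell {nbr : ℕ → ι → Finset ι}
    (hnbr : ∀ k x, {y | cell k y ∈ nbr k (cell k x)} ∈ 𝓝 x) (hK : IsCompact K) (k : ℕ) :
    ∃ s : Finset ι, ∀ x ∈ K, cell k x ∈ s := by
  classical
  obtain ⟨t, -, ht⟩ := hK.elim_nhds_subcover _ fun x _ => hnbr k x
  refine ⟨t.biUnion fun x => nbr k (cell k x), fun x hx => ?_⟩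
  obtain ⟨z, hz, hx⟩ := mem_iUnion₂.1 (ht hx)
  exact Finset.mem_biUnion.2 ⟨z, hz, hx⟩

open scoped CompactlySupported

/-- **Frostman's lemma** for compact sets and nested partitions: a compact set of positive net
content carries a nonzero measure which is controlled on the cells. -/
theorem exists_measure_of_netContent_pos [T2Space X] [LocallyCompactSpace X] [MeasurableSpace X]
    [BorelSpace X] {nbr : ℕ → ι → Finset ι} {N : ℕ} (hN : ∀ k i, (nbr k i).card ≤ N)
    (hnbr : ∀ k x, {y | cell k y ∈ nbr k (cell k x)} ∈ 𝓝 x) (hw : ∀ k, w k ≠ ∞)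
    {s : ℕ → ℝ≥0∞} (hs0 : ∀ k, s k ≠ 0) (hs : ∑' k, s k ≠ ∞) (hK : IsCompact K)
    (hpos : 0 < netContent cell (fun k => w k * s k) K) :
    ∃ μ : Measure X, IsFiniteMeasure μ ∧ μ ≠ 0 ∧ μ Kᶜ = 0 ∧
      ∀ k x S, IsCompact S → S ⊆ interior {y | cell k y ∈ nbr k (cell k x)} →
        μ S ≤ N * w k := by
  have hbump : ∀ S U : Set X, IsCompact S → IsOpen U → S ⊆ U →
      ∃ g : C_c(X, ℝ), (∀ x ∈ S, g x = 1) ∧ (∀ x ∉ U, g x = 0) ∧ (∀ x, 0 ≤ g x) ∧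
        ∀ x, g x ≤ 1 := by
    intro S U hS hU hSU
    obtain ⟨f, h1, h0, hc, hf⟩ := exists_continuous_one_zero_of_isCompact hS hU.isClosed_compl
      (disjoint_compl_right_iff_subset.2 hSU)
    exact ⟨⟨f, hc⟩, h1, fun x hx => h0 hx, fun x => (hf x).1, fun x => (hf x).2⟩
  have hfin : ∀ g : C_c(X, ℝ), fracCost cell w K g ≠ ∞ := by
    intro g
    obtain ⟨s, hs⟩ := hK.exists_finset_cell hnbr 0
    obtain ⟨M, hM⟩ := (hK.image g.continuous).bddAbove
    refine ne_top_of_le_ne_top ?_ (fracCost_le (M := M) (k := 0) s fun x hx =>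
      Or.inr ⟨hM (mem_image_of_mem _ hx), hs x hx⟩)
    have := hw 0
    finiteness
  obtain ⟨g₀, hg₀, -, -, -⟩ := hbump K univ hK isOpen_univ (subset_univ _)
  set p : C_c(X, ℝ) → ℝ := fun g => (fracCost cell w K g).toReal
  have hp₀ : 0 < p g₀ :=
    ENNReal.toReal_pos (fracCost_pos hs0 hs hpos fun x hx => (hg₀ x hx).ge).ne' (hfin _)
  have hp_zero : ∀ g : C_c(X, ℝ), (∀ x ∈ K, g x ≤ 0) → p g = 0 := fun g hg => by
    simp only [p, fracCost_eq_zero hg, ENNReal.toReal_zero]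
  have hg₀ne : g₀ ≠ 0 := by
    rintro rfl
    exact hp₀.ne' (hp_zero _ fun x _ => le_rfl)
  obtain ⟨Λ, hΛ₀, hΛ⟩ := exists_extension_of_le_sublinear
    (LinearPMap.mkSpanSingleton g₀ (p g₀) hg₀ne) p
    (fun t ht g => by
      simp only [p, CompactlySupportedContinuousMap.coe_smul]
      rw [fracCost_smul ht, ENNReal.toReal_mul, ENNReal.toReal_ofReal ht.le])
    (fun g h => by
      simp only [p, CompactlySupportedContinuousMap.coe_add]
      rw [← ENNReal.toReal_add (hfin g) (hfin h)]
      exact ENNReal.toReal_mono (ENNReal.add_ne_top.2 ⟨hfin g, hfin h⟩) (fracCost_add_le _ _))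
    (by
      rintro ⟨x, hx⟩
      obtain ⟨t, rfl⟩ := Submodule.mem_span_singleton.1 hx
      refine (LinearPMap.mkSpanSingleton'_apply _ _ _ t hx).trans_le ?_
      rcases le_or_gt t 0 with ht | ht
      · exact (mul_nonpos_of_nonpos_of_nonneg ht hp₀.le).trans ENNReal.toReal_nonneg
      · simp only [p, CompactlySupportedContinuousMap.coe_smul]
        rw [fracCost_smul ht, ENNReal.toReal_mul, ENNReal.toReal_ofReal ht.le]
        rfl)
  have hΛpos : ∀ g : C_c(X, ℝ), 0 ≤ g → 0 ≤ Λ g := fun g hg => by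
    have h1 := hΛ (-g)
    rw [hp_zero (-g) fun x _ => neg_nonpos.2 (hg x), map_neg] at h1
    linarith
  let Λ' : C_c(X, ℝ) →ₚ[ℝ] ℝ := PositiveLinearMap.mk₀ Λ hΛpos
  have hΛ' : ∀ g, Λ' g = Λ g := fun _ => rfl
  have hΛg₀ : Λ g₀ = p g₀ :=
    (hΛ₀ ⟨g₀, Submodule.mem_span_singleton_self g₀⟩).trans (LinearPMap.mkSpanSingleton_apply _ _ _ _)
  set μ := RealRMK.rieszMeasure Λ'
  have hμ : ∀ (g : C_c(X, ℝ)) (S : Set X), IsCompact S → (∀ x, 0 ≤ g x) → (∀ x ∈ S, g x = 1) →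
      μ S ≤ fracCost cell w K g := by
    intro g S hS h0 h1
    refine (RealRMK.rieszMeasure_le_of_eq_one Λ' h0 hS h1).trans ?_
    exact ENNReal.ofReal_le_of_le_toReal (hΛ g)
  have hμK : μ Kᶜ = 0 := by
    rw [hK.isClosed.isOpen_compl.measure_eq_iSup_isCompact]
    simp only [ENNReal.iSup_eq_zero]
    intro S hSK hS
    obtain ⟨g, h1, h0, hnn, -⟩ := hbump S Kᶜ hS hK.isClosed.isOpen_compl hSK
    refine le_antisymm ((hμ g S hS hnn h1).trans_eq (fracCost_eq_zero fun x hx => ?_)) zero_le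
    exact (h0 x fun h => h hx).le
  refine ⟨μ, ⟨?_⟩, ?_, hμK, ?_⟩
  · rw [← union_compl_self K]
    exact (measure_union_le _ _).trans_lt (by rw [hμK, add_zero]; exact hK.measure_lt_top)
  · intro h
    have := RealRMK.integral_rieszMeasure Λ' g₀
    rw [show RealRMK.rieszMeasure Λ' = 0 from h, integral_zero_measure, hΛ', hΛg₀] at this
    exact hp₀.ne this
  · intro k x S hS hSx
    obtain ⟨g, h1, h0, hnn, hle⟩ := hbump S _ hS isOpen_interior hSx
    refine (hμ g S hS hnn h1).trans ?_
    refine (fracCost_le (M := 1) (k := k) (nbr k (cell k x)) fun y _ => ?_).trans ?_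
    · by_cases hy : y ∈ interior {y | cell k y ∈ nbr k (cell k x)}
      · exact Or.inr ⟨hle y, interior_subset (s := {y | cell k y ∈ nbr k (cell k x)}) hy⟩
      · exact Or.inl (h0 y hy).le
    · rw [ENNReal.ofReal_one, one_mul]
      gcongr
      exact hN _ _

end FractionalCost

section ParabolicGrid

lemma Int.floor_pow_mul_eq_of_le {b : ℕ} (hb : b ≠ 0) {m n : ℕ} (hmn : m ≤ n) {x y : ℝ}
    (h : ⌊(b : ℝ) ^ n * x⌋ = ⌊(b : ℝ) ^ n * y⌋) : ⌊(b : ℝ) ^ m * x⌋ = ⌊(b : ℝ) ^ m * y⌋ := by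
  have key : ∀ a : ℝ, ⌊(b : ℝ) ^ m * a⌋ = ⌊(b : ℝ) ^ n * a⌋ / ((b ^ (n - m) : ℕ) : ℤ) := by
    intro a
    rw [← Int.floor_div_natCast]
    congr 1
    rw [_root_.eq_div_iff (by positivity), Nat.cast_pow, mul_right_comm, ← pow_add,
      Nat.add_sub_cancel' hmn]
  rw [key, key, h]

lemma floor_pow_mul_mem_Icc {m : ℕ} {a y : ℝ} (h : a - (1 / 2) ^ m < y)
    (h' : y < a + 3 * (1 / 2) ^ m) :
    ⌊2 ^ m * y⌋ ∈ Finset.Icc (⌊2 ^ m * a⌋ - 1) (⌊2 ^ m * a⌋ + 3) := by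
  have hm : (2 : ℝ) ^ m * (1 / 2) ^ m = 1 := by rw [← mul_pow]; norm_num
  have h2 : (0 : ℝ) < 2 ^ m := by positivity
  have h1 := mul_lt_mul_of_pos_left h h2
  have h3 := mul_lt_mul_of_pos_left h' h2
  have ha := Int.floor_le ((2 : ℝ) ^ m * a)
  have ha' := Int.lt_floor_add_one ((2 : ℝ) ^ m * a)
  rw [Finset.mem_Icc]
  constructor
  · rw [Int.le_floor]
    push_cast
    linarith
  · rw [← Int.lt_add_one_iff, Int.floor_lt]
    push_cast
    linarith

/-- The dyadic level in space which corresponds to the dyadic level `k` in time. -/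
def spaceLevel (α : ℝ) (k : ℕ) : ℕ := ⌈k / α⌉₊

lemma half_pow_spaceLevel_le (α : ℝ) (k : ℕ) :
    (1 / 2 : ℝ) ^ spaceLevel α k ≤ ((1 / 2) ^ k) ^ (1 / α) := by
  rw [← Real.rpow_natCast_mul (by norm_num), ← Real.rpow_natCast, mul_one_div]
  exact Real.rpow_le_rpow_of_exponent_ge (by norm_num) (by norm_num) (Nat.le_ceil _)

lemma rpow_half_pow_le {α : ℝ} (hα : 0 < α) (k : ℕ) :
    ((1 / 2 : ℝ) ^ k) ^ (1 / α) ≤ 2 * (1 / 2) ^ spaceLevel α k := by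
  have h1 : (spaceLevel α k : ℝ) - 1 ≤ k / α := by
    have := Nat.ceil_lt_add_one (a := k / α) (by positivity)
    rw [spaceLevel]
    linarith
  calc ((1 / 2 : ℝ) ^ k) ^ (1 / α) = (1 / 2) ^ (k / α) := by
        rw [← Real.rpow_natCast_mul (by norm_num), mul_one_div]
    _ ≤ (1 / 2) ^ ((spaceLevel α k : ℝ) - 1) :=
        Real.rpow_le_rpow_of_exponent_ge (by norm_num) (by norm_num) h1
    _ = 2 * (1 / 2) ^ spaceLevel α k := by
        rw [Real.rpow_sub (by norm_num), Real.rpow_natCast, Real.rpow_one]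
        ring

variable {α : ℝ} {d : ℕ}

/-- The index of the half-open `α`-parabolic dyadic cell of level `k` containing a point. -/
def pCell (α : ℝ) {d : ℕ} (k : ℕ) (z : ℝ × (Fin d → ℝ)) : ℤ × (Fin d → ℤ) :=
  (⌊2 ^ k * z.1⌋, fun j => ⌊2 ^ spaceLevel α k * z.2 j⌋)

lemma netNested_pCell (hα : 0 < α) : NetNested (pCell α (d := d)) := by
  intro k l x y hkl h
  have hlev : spaceLevel α k ≤ spaceLevel α l := by
    unfold spaceLevel
    gcongr
  simp only [pCell, Prod.mk.injEq] at h ⊢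
  refine ⟨?_, funext fun j => ?_⟩
  · exact_mod_cast Int.floor_pow_mul_eq_of_le (b := 2) two_ne_zero hkl (by exact_mod_cast h.1)
  · exact_mod_cast Int.floor_pow_mul_eq_of_le (b := 2) two_ne_zero hlev
      (by exact_mod_cast congrFun h.2 j)

/-- The indices of the cells close to a given one. -/
def pNbr {d : ℕ} (i : ℤ × (Fin d → ℤ)) : Finset (ℤ × (Fin d → ℤ)) :=
  Finset.Icc (i.1 - 1) (i.1 + 3) ×ˢ Fintype.piFinset fun j => Finset.Icc (i.2 j - 1) (i.2 j + 3)

lemma card_pNbr (i : ℤ × (Fin d → ℤ)) : (pNbr i).card = 5 ^ (d + 1) := by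
  have h : ∀ a : ℤ, a + 3 + 1 - (a - 1) = 5 := fun a => by ring
  simp [pNbr, Fintype.card_piFinset, h, pow_succ']

/-- An open box around a point which only meets neighbouring cells. -/
def pBox (α : ℝ) {d : ℕ} (k : ℕ) (z : ℝ × (Fin d → ℝ)) : Set (ℝ × (Fin d → ℝ)) :=
  Set.Ioo (z.1 - (1 / 2) ^ k) (z.1 + 3 * (1 / 2) ^ k) ×ˢ Set.pi univ fun j =>
    Set.Ioo (z.2 j - (1 / 2) ^ spaceLevel α k) (z.2 j + 3 * (1 / 2) ^ spaceLevel α k)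

lemma isOpen_pBox (k : ℕ) (z : ℝ × (Fin d → ℝ)) : IsOpen (pBox α k z) :=
  isOpen_Ioo.prod (isOpen_set_pi finite_univ fun _ _ => isOpen_Ioo)

lemma pBox_subset (k : ℕ) (z : ℝ × (Fin d → ℝ)) :
    pBox α k z ⊆ {y | pCell α k y ∈ pNbr (pCell α k z)} := by
  rintro y ⟨h1, h2⟩
  refine Finset.mem_product.2 ⟨floor_pow_mul_mem_Icc h1.1 h1.2, Fintype.mem_piFinset.2 fun j => ?_⟩
  exact floor_pow_mul_mem_Icc (h2 j trivial).1 (h2 j trivial).2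

lemma pNbr_mem_nhds (k : ℕ) (z : ℝ × (Fin d → ℝ)) :
    {y | pCell α k y ∈ pNbr (pCell α k z)} ∈ 𝓝 z := by
  refine Filter.mem_of_superset ((isOpen_pBox (α := α) k z).mem_nhds ?_) (pBox_subset k z)
  have h : ∀ (a : ℝ) (m : ℕ), a ∈ Set.Ioo (a - (1 / 2) ^ m) (a + 3 * (1 / 2) ^ m) := fun a m => by
    have : (0 : ℝ) < (1 / 2) ^ m := by positivity
    constructor <;> linarith
  exact ⟨h _ _, fun j _ => h _ _⟩

lemma cylinder_subset_interior (hα : 0 < α) {c : ℝ} (hc : 0 < c) {k : ℕ} (hck : c ≤ (1 / 2) ^ k)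
    (t : ℝ) (x : Fin d → ℝ) :
    Set.Icc t (t + c) ×ˢ Set.Icc x (fun j => x j + c ^ (1 / α)) ⊆
      interior {y | pCell α k y ∈ pNbr (pCell α k (t, x))} := by
  refine Subset.trans ?_ (interior_maximal (pBox_subset k (t, x)) (isOpen_pBox k (t, x)))
  have hpos : ∀ m : ℕ, (0 : ℝ) < (1 / 2) ^ m := fun m => by positivity
  have h1 : c ^ (1 / α) ≤ 2 * (1 / 2) ^ spaceLevel α k :=
    (Real.rpow_le_rpow hc.le hck (by positivity)).trans (rpow_half_pow_le hα k)
  rintro y ⟨hy1, hy2⟩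
  refine ⟨⟨?_, ?_⟩, fun j _ => ⟨?_, ?_⟩⟩
  · have := hy1.1
    have := hpos k
    dsimp only
    linarith
  · have := hy1.2
    have := hpos k
    dsimp only
    linarith
  · have := hy2.1 j
    have := hpos (spaceLevel α k)
    dsimp only
    linarith
  · have := hy2.2 j
    have := hpos (spaceLevel α k)
    dsimp only at *
    linarith

/-- The closed `α`-parabolic cylinder containing a dyadic cell of level `k`. -/
def pCyl (α : ℝ) {d : ℕ} (q : ℕ × ℤ × (Fin d → ℤ)) : Set (ℝ × (Fin d → ℝ)) :=
  Set.Icc ((1 / 2) ^ q.1 * q.2.1 : ℝ) ((1 / 2) ^ q.1 * q.2.1 + (1 / 2) ^ q.1) ×ˢ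
    Set.Icc (fun j => (1 / 2) ^ spaceLevel α q.1 * q.2.2 j : Fin d → ℝ)
      (fun j => (1 / 2) ^ spaceLevel α q.1 * q.2.2 j + ((1 / 2) ^ q.1) ^ (1 / α))

lemma isPCyl_pCyl (q : ℕ × ℤ × (Fin d → ℤ)) : IsPCyl α (pCyl α q) :=
  ⟨_, _, (1 / 2) ^ q.1, ⟨by positivity, pow_le_one₀ (by norm_num) (by norm_num)⟩, rfl⟩

lemma half_pow_mul_floor_le (m : ℕ) (a : ℝ) :
    (1 / 2) ^ m * (⌊2 ^ m * a⌋ : ℝ) ≤ a ∧ a ≤ (1 / 2) ^ m * (⌊2 ^ m * a⌋ : ℝ) + (1 / 2) ^ m := by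
  have hm : (1 / 2 : ℝ) ^ m * 2 ^ m = 1 := by rw [← mul_pow]; norm_num
  have h2 : (0 : ℝ) ≤ (1 / 2) ^ m := by positivity
  have h1 := mul_le_mul_of_nonneg_left (Int.floor_le ((2 : ℝ) ^ m * a)) h2
  have h3 := mul_le_mul_of_nonneg_left (Int.lt_floor_add_one ((2 : ℝ) ^ m * a)).le h2
  rw [← mul_assoc, hm, one_mul] at h1 h3
  exact ⟨h1, by linarith⟩

lemma mem_pCyl (k : ℕ) (z : ℝ × (Fin d → ℝ)) : z ∈ pCyl α (k, pCell α k z) :=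
  ⟨half_pow_mul_floor_le _ _, fun _ => (half_pow_mul_floor_le _ _).1, fun _ =>
    (half_pow_mul_floor_le _ _).2.trans (add_le_add le_rfl (half_pow_spaceLevel_le α k))⟩

lemma ediam_pCyl_le (q : ℕ × ℤ × (Fin d → ℤ)) :
    Metric.ediam (pCyl α q) ≤ ENNReal.ofReal (((1 / 2) ^ q.1) ^ (min 1 (1 / α))) := by
  have h0 : (0 : ℝ) < (1 / 2) ^ q.1 := by positivity
  have h1 : (1 / 2 : ℝ) ^ q.1 ≤ 1 := pow_le_one₀ (by norm_num) (by norm_num)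
  refine Metric.ediam_le fun y hy z hz => ?_
  rw [edist_dist]
  refine ENNReal.ofReal_le_ofReal ?_
  rw [Prod.dist_eq]
  refine max_le ?_ ((dist_pi_le_iff (by positivity)).2 fun j => ?_)
  · refine (Real.dist_le_of_mem_Icc hy.1 hz.1).trans ?_
    rw [add_sub_cancel_left]
    conv_lhs => rw [← Real.rpow_one ((1 / 2 : ℝ) ^ q.1)]
    exact Real.rpow_le_rpow_of_exponent_ge h0 h1 (min_le_left _ _)
  · refine (Real.dist_le_of_mem_Icc ⟨hy.2.1 j, hy.2.2 j⟩ ⟨hz.2.1 j, hz.2.2 j⟩).trans ?_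
    rw [add_sub_cancel_left]
    exact Real.rpow_le_rpow_of_exponent_ge h0 h1 (min_le_right _ _)

lemma tsum_ofReal_half_pow_rpow_ne_top {σ : ℝ} (hσ : 0 < σ) :
    ∑' k : ℕ, ENNReal.ofReal (((1 / 2 : ℝ) ^ k) ^ σ) ≠ ∞ := by
  refine Summable.tsum_ofReal_ne_top ?_
  have h : ∀ k : ℕ, ((1 / 2 : ℝ) ^ k) ^ σ = ((1 / 2 : ℝ) ^ σ) ^ k := fun k => by
    rw [← Real.rpow_natCast_mul (by norm_num), mul_comm, Real.rpow_mul_natCast (by norm_num)]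
  simp only [h]
  exact summable_geometric_of_lt_one (by positivity)
    (Real.rpow_lt_one (by norm_num) (by norm_num) hσ)

/-- A set of vanishing dyadic content has finite parabolic Hausdorff measure. -/
lemma pHaus_ne_top_of_netContent_eq_zero (hα : 0 < α) {β : ℝ} (hβ : 0 < β)
    {A : Set (ℝ × (Fin d → ℝ))}
    (h : netContent (pCell α)
      (fun k => ENNReal.ofReal (((1 / 2) ^ k) ^ (β * min 1 (1 / α)))) A = 0) :
    pHaus α β A ≠ ∞ := by
  classical
  set θ := min 1 (1 / α)
  have hθ : 0 < θ := lt_min one_pos (by positivity)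
  set w : ℕ → ℝ≥0∞ := fun k => ENNReal.ofReal (((1 / 2) ^ k) ^ (β * θ)) with hw
  have hwanti : Antitone w := fun k l hkl => ENNReal.ofReal_le_ofReal
    (Real.rpow_le_rpow (by positivity)
      (pow_le_pow_of_le_one (by norm_num) (by norm_num) hkl) (by positivity))
  have hwpos : ∀ k, w k ≠ 0 := fun k => by
    simp only [hw, ne_eq, ENNReal.ofReal_eq_zero, not_le]
    positivity
  have hwtop : ∀ k, w k ≠ ∞ := fun k => ENNReal.ofReal_ne_top
  have hwsum : ∑' k, w k ≠ ∞ := tsum_ofReal_half_pow_rpow_ne_top (mul_pos hβ hθ)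
  have hdiam : ∀ q : ℕ × ℤ × (Fin d → ℤ), Metric.ediam (pCyl α q) ^ β ≤ w q.1 := fun q => by
    refine (ENNReal.rpow_le_rpow (ediam_pCyl_le q) hβ.le).trans_eq ?_
    rw [ENNReal.ofReal_rpow_of_nonneg (by positivity) hβ.le, ← Real.rpow_mul (by positivity),
      mul_comm]
  refine ne_top_of_le_ne_top (b := w 0 + ∑' k, w k) (ENNReal.add_ne_top.2 ⟨hwtop 0, hwsum⟩)
    (iSup₂_le fun δ hδ => ?_)
  obtain ⟨L, hL⟩ : ∃ L : ℕ, ((1 / 2 : ℝ) ^ L) ^ θ ≤ δ := by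
    obtain ⟨L, hL⟩ := exists_pow_lt_of_lt_one (y := (1 / 2 : ℝ)) (Real.rpow_pos_of_pos hδ θ⁻¹)
      (by norm_num)
    refine ⟨L, (Real.rpow_le_rpow (by positivity) hL.le hθ.le).trans_eq ?_⟩
    rw [← Real.rpow_mul hδ.le, inv_mul_cancel₀ hθ.ne', Real.rpow_one]
  have hfin : netContent (pCell α) w A ≠ ∞ := h.trans_ne ENNReal.zero_ne_top
  obtain ⟨F, hF, hFw⟩ := exists_netCovers_le hfin (ENNReal.half_pos (hwpos L)).ne'
  rw [h, zero_add] at hFw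
  have hFL : ∀ q ∈ F, L ≤ q.1 := by
    intro q hq
    by_contra! hlt
    have h1 : w q.1 ≤ netCost w F := by
      refine le_trans ?_ (ENNReal.le_tsum q)
      rw [Set.indicator_of_mem hq]
    exact absurd ((hwanti hlt.le).trans (h1.trans hFw))
      (not_le.2 (ENNReal.half_lt_self (hwpos L) (hwtop L)))
  obtain ⟨e⟩ : Nonempty (ℕ ≃ ℕ × ℤ × (Fin d → ℤ)) := nonempty_equiv_of_countable
  let q : ℕ → ℕ × ℤ × (Fin d → ℤ) := fun n => if e n ∈ F then e n else (L + n, (e n).2)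
  have hqL : ∀ n, L ≤ (q n).1 := fun n => by
    by_cases hn : e n ∈ F
    · simp only [q, if_pos hn]
      exact hFL _ hn
    · simp only [q, if_neg hn]
      exact Nat.le_add_right _ _
  have hcov : A ⊆ ⋃ n, pCyl α (q n) := fun z hz => by
    obtain ⟨k, hk⟩ := hF z hz
    refine mem_iUnion.2 ⟨e.symm (k, pCell α k z), ?_⟩
    simpa [q, hk] using mem_pCyl k z
  have hsmall : ∀ n, Metric.ediam (pCyl α (q n)) ≤ ENNReal.ofReal δ := fun n => by
    refine (ediam_pCyl_le _).trans (ENNReal.ofReal_le_ofReal (le_trans ?_ hL))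
    exact Real.rpow_le_rpow (by positivity)
      (pow_le_pow_of_le_one (by norm_num) (by norm_num) (hqL n)) hθ.le
  refine iInf_le_of_le (fun n => pCyl α (q n)) ?_
  refine iInf_le_of_le hcov ?_
  refine iInf_le_of_le (fun n => isPCyl_pCyl _) ?_
  refine iInf_le_of_le hsmall ?_
  calc ∑' n, Metric.ediam (pCyl α (q n)) ^ β
      ≤ ∑' n, (F.indicator (fun q => w q.1) (e n) + w n) := by
        refine ENNReal.tsum_le_tsum fun n => (hdiam _).trans ?_
        by_cases hn : e n ∈ F
        · simp only [q, if_pos hn, Set.indicator_of_mem hn]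
          exact le_self_add
        · simp only [q, if_neg hn]
          exact (hwanti (Nat.le_add_left n L)).trans le_add_self
    _ = netCost w F + ∑' n, w n := by
        rw [ENNReal.tsum_add, e.tsum_eq (F.indicator fun q => w q.1), netCost]
    _ ≤ w 0 + ∑' k, w k := by
        gcongr
        exact hFw.trans (ENNReal.half_le_self.trans (hwanti (Nat.zero_le L)))

end ParabolicGrid

/-- The dyadic form of the parabolic Frostman lemma: the measure is bounded by a power of the side
length `c` in time, with an exponent `β * min 1 (1 / α)`. -/
theorem exists_parabolic_frostman_measure {d : ℕ} {α β β' : ℝ} (hα : 0 < α) (hβ : 0 ≤ β)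
    (hββ' : β < β') {A : Set (ℝ × (Fin d → ℝ))} (hA : MeasurableSet A)
    (hH : pHaus α β' A = ∞) :
    ∃ μ : Measure (ℝ × (Fin d → ℝ)), IsProbabilityMeasure μ ∧ μ Aᶜ = 0 ∧
      ∃ K : ℝ, 0 < K ∧ ∀ c ∈ Set.Ioc (0:ℝ) 1, ∀ (t : ℝ) (x : Fin d → ℝ),
        μ (Set.Icc t (t + c) ×ˢ Set.Icc x (fun i => x i + c ^ (1/α))) ≤
          ENNReal.ofReal (K * c ^ (β * min 1 (1 / α))) := by
  set θ := min 1 (1 / α)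
  have hθ : 0 < θ := lt_min one_pos (by positivity)
  set w : ℕ → ℝ≥0∞ := fun k => ENNReal.ofReal (((1 / 2) ^ k) ^ (β * θ))
  set s : ℕ → ℝ≥0∞ := fun k => ENNReal.ofReal (((1 / 2) ^ k) ^ ((β' - β) * θ))
  have hs0 : ∀ k, s k ≠ 0 := fun k => by
    simp only [s, ne_eq, ENNReal.ofReal_eq_zero, not_le]
    positivity
  have hs : ∑' k, s k ≠ ∞ :=
    tsum_ofReal_half_pow_rpow_ne_top (mul_pos (sub_pos.2 hββ') hθ)
  have hws : (fun k => w k * s k) = fun k => ENNReal.ofReal (((1 / 2) ^ k) ^ (β' * θ)) := by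
    funext k
    rw [← ENNReal.ofReal_mul (by positivity), ← Real.rpow_add (by positivity)]
    ring_nf
  have hpos : 0 < netContent (pCell α) (fun k => w k * s k) A := by
    rw [pos_iff_ne_zero, hws]
    exact fun h => pHaus_ne_top_of_netContent_eq_zero hα (hβ.trans_lt hββ') h hH
  have hN : ∀ (_ : ℕ) (i : ℤ × (Fin d → ℤ)), (pNbr i).card ≤ 5 ^ (d + 1) :=
    fun _ i => (card_pNbr i).le
  obtain ⟨K, hKA, hK, hKpos⟩ := exists_isCompact_netContent_pos (netNested_pCell hα) hN
    pNbr_mem_nhds hA.analyticSet hpos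
  obtain ⟨μ, hfin, hμ0, hμK, hμ⟩ := exists_measure_of_netContent_pos hN pNbr_mem_nhds
    (fun k => ENNReal.ofReal_ne_top) hs0 hs hK hKpos
  have : NeZero μ := ⟨hμ0⟩
  have hm : 0 < (μ univ).toReal :=
    ENNReal.toReal_pos (Measure.measure_univ_ne_zero.2 hμ0) (measure_ne_top μ _)
  refine ⟨(μ univ)⁻¹ • μ, inferInstance, ?_, (μ univ).toReal⁻¹ * (5 ^ (d + 1) * 2 ^ (β * θ)),
    by positivity, fun c hc t x => ?_⟩
  · rw [Measure.smul_apply, measure_mono_null (compl_subset_compl.2 hKA) hμK, smul_zero]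
  obtain ⟨k, hk, hck⟩ := exists_nat_pow_near_of_lt_one hc.1 hc.2 (y := (1 / 2 : ℝ))
    (by norm_num) (by norm_num)
  have hwk : w k ≤ ENNReal.ofReal (2 ^ (β * θ) * c ^ (β * θ)) := by
    rw [← Real.mul_rpow (by norm_num) hc.1.le]
    refine ENNReal.ofReal_le_ofReal (Real.rpow_le_rpow (by positivity) ?_ (by positivity))
    rw [pow_succ] at hk
    linarith
  calc ((μ univ)⁻¹ • μ) (Set.Icc t (t + c) ×ˢ Set.Icc x (fun i => x i + c ^ (1 / α)))
      ≤ (μ univ)⁻¹ * ((5 ^ (d + 1) : ℕ) * w k) := by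
        rw [Measure.smul_apply, smul_eq_mul]
        gcongr
        exact hμ k (t, x) _ (isCompact_Icc.prod isCompact_Icc)
          (cylinder_subset_interior hα hc.1 hck t x)
    _ ≤ (μ univ)⁻¹ * ((5 ^ (d + 1) : ℕ) * ENNReal.ofReal (2 ^ (β * θ) * c ^ (β * θ))) := by
        gcongr
    _ = ENNReal.ofReal ((μ univ).toReal⁻¹ * (5 ^ (d + 1) * 2 ^ (β * θ)) * c ^ (β * θ)) := by
        rw [mul_assoc, mul_assoc,
          ENNReal.ofReal_mul (p := (μ univ).toReal⁻¹) (by positivity),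
          ENNReal.ofReal_mul (p := 5 ^ (d + 1)) (by positivity), ENNReal.ofReal_inv_of_pos hm,
          ENNReal.ofReal_toReal (measure_ne_top μ _), ENNReal.ofReal_pow (by norm_num)]
        norm_num

theorem parabolic_frostman {d : ℕ} (α β : ℝ) (hα : 0 < α)
    (A : Set (ℝ × (Fin d → ℝ))) (hA : MeasurableSet A)
    (hdim : ENNReal.ofReal β < pDim α A) :
    ∃ μ : Measure (ℝ × (Fin d → ℝ)), IsProbabilityMeasure μ ∧ μ Aᶜ = 0 ∧
      ∃ K : ℝ, 0 < K ∧ ∀ c ∈ Set.Ioc (0:ℝ) 1, ∀ (t : ℝ) (x : Fin d → ℝ),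
        (α ≤ 1 →
          μ (Set.Icc t (t + c) ×ˢ Set.Icc x (fun i => x i + c ^ (1/α))) ≤
            ENNReal.ofReal (K * c ^ β)) ∧
        (1 ≤ α →
          μ (Set.Icc t (t + c) ×ˢ Set.Icc x (fun i => x i + c ^ (1/α))) ≤
            ENNReal.ofReal (K * c ^ (β/α))) := by
  obtain ⟨β', hH, hβ'⟩ : ∃ β' : ℝ≥0, pHaus α (β' : ℝ) A = ∞ ∧ ENNReal.ofReal β < β' := by
    simpa only [pDim, lt_iSup_iff, exists_prop] using hdim
  have hmax : max β 0 < (β' : ℝ) := by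
    rw [← Real.coe_toNNReal']
    exact NNReal.coe_lt_coe.2 (ENNReal.coe_lt_coe.1 hβ')
  obtain ⟨μ, hμ, hμA, K, hK, h⟩ :=
    exists_parabolic_frostman_measure hα (le_max_right β 0) hmax hA hH
  refine ⟨μ, hμ, hμA, K, hK, fun c hc t x => ⟨fun hα1 => ?_, fun hα1 => ?_⟩⟩
  all_goals
    refine (h c hc t x).trans (ENNReal.ofReal_le_ofReal (mul_le_mul_of_nonneg_left
      (Real.rpow_le_rpow_of_exponent_ge hc.1 hc.2 ?_) hK.le))
  · rw [min_eq_left ((one_le_div hα).2 hα1), mul_one]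
    exact le_max_left _ _
  · rw [min_eq_right ((div_le_one hα).2 hα1), mul_one_div]
    gcongr
    exact le_max_left _ _
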